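/- If β/(1+β) < α ≤ β < 1 and β > 0, then every x ∈ E(α,β) has an eventually periodic Lüroth digit sequence; consequently E(α,β) is countable and has Hausdorff dimension 0. -/

import Mathlib

open Filter MeasureTheory Set

/-- The Lüroth transformation on (0,1]. -/
noncomputable def lurothT (x : ℝ) : ℝ :=
  (⌊1/x⌋ : ℝ) * ((⌊1/x⌋ : ℝ) + 1) * (x - 1/((⌊1/x⌋ : ℝ) + 1))

/-- The n-th Lüroth digit (n ≥ 1): d₁(x) = ⌊1/x⌋ + 1, dₙ(x) = d₁(T^[n-1] x). -/
noncomputable def lurothD (n : ℕ) (x : ℝ) : ℕ :=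
  (⌊1 / (lurothT^[n-1] x)⌋ + 1).toNat

/-- The n-th maximal run-length function. -/
noncomputable def runLen (n : ℕ) (x : ℝ) : ℕ :=
  sSup {k : ℕ | 1 ≤ k ∧ ∃ j : ℕ, j + k ≤ n ∧
    ∀ i : ℕ, 1 ≤ i → i ≤ k → lurothD (j + i) x = lurothD (j + 1) x}

/-- The level set E(α,β). -/
noncomputable def Eab (a b : ℝ) : Set ℝ :=
  {x | x ∈ Set.Ioc (0:ℝ) 1 ∧
    Filter.liminf (fun n : ℕ => (runLen n x : ℝ) / n) Filter.atTop = a ∧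
    Filter.limsup (fun n : ℕ => (runLen n x : ℝ) / n) Filter.atTop = b}

/-- The series ∑_{t=2}^∞ (1/(2^u t(t-1)))^s. -/
noncomputable def lurothF (u s : ℝ) : ℝ :=
  ∑' t : ℕ, (1 / (2 ^ u * ((t : ℝ) + 2) * ((t : ℝ) + 1))) ^ s

/-- The Lüroth digit sequence of x is eventually periodic. -/
def LurothEventuallyPeriodic (x : ℝ) : Prop :=
  ∃ j : ℕ, ∃ k : ℕ, 1 ≤ k ∧ ∀ n : ℕ, j < n → lurothD (n + k) x = lurothD n x

/-- Every element of the set defining `runLen n x` is at most `runLen n x`. -/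
lemma le_runLen {n k j : ℕ} {x : ℝ} (hk : 1 ≤ k) (hj : j + k ≤ n)
    (h : ∀ i : ℕ, 1 ≤ i → i ≤ k → lurothD (j + i) x = lurothD (j + 1) x) :
    k ≤ runLen n x :=
  le_csSup ⟨n, fun _ ⟨_, _, h, _⟩ => by omega⟩ ⟨hk, j, hj, h⟩

/-- The maximal run length is attained. -/
lemma exists_run_eq_runLen {n : ℕ} (hn : 1 ≤ n) (x : ℝ) :
    1 ≤ runLen n x ∧ ∃ j : ℕ, j + runLen n x ≤ n ∧
      ∀ i : ℕ, 1 ≤ i → i ≤ runLen n x → lurothD (j + i) x = lurothD (j + 1) x := by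
  refine Nat.sSup_mem (s := {k : ℕ | 1 ≤ k ∧ ∃ j : ℕ, j + k ≤ n ∧
    ∀ i : ℕ, 1 ≤ i → i ≤ k → lurothD (j + i) x = lurothD (j + 1) x})
    ⟨1, le_rfl, 0, by omega, fun i h1 h2 => ?_⟩ ⟨n, fun _ ⟨_, _, h, _⟩ => by omega⟩
  obtain rfl : i = 1 := by omega
  rfl

lemma runLen_le (n : ℕ) (x : ℝ) : runLen n x ≤ n :=
  csSup_le' fun _ ⟨_, _, h, _⟩ => by omega

/-- After a break at `m`, the maximal run length cannot grow for another `runLen m x` digits. -/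
lemma runLen_add_runLen_le {x : ℝ} {m : ℕ} (hm : 1 ≤ m)
    (hne : lurothD (m + 1) x ≠ lurothD m x) : runLen (m + runLen m x) x ≤ runLen m x := by
  obtain ⟨h1, j, hj, hr⟩ := exists_run_eq_runLen (n := m + runLen m x) (by omega) x
  by_contra! hlt
  by_cases hle : j + runLen (m + runLen m x) x ≤ m
  · have := le_runLen h1 hle hr
    omega
  · have h2 := hr (m - j) (by omega) (by omega)
    have h3 := hr (m + 1 - j) (by omega) (by omega)
    rw [show j + (m - j) = m by omega] at h2
    rw [show j + (m + 1 - j) = m + 1 by omega] at h3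
    exact hne (h3.trans h2.symm)

/-- If `runLen n x < b * n` for all large `n`, with `b < 1`, then the digits change at arbitrarily
late positions. -/
lemma exists_lurothD_succ_ne {x b : ℝ} (hb : b < 1) {N : ℕ}
    (hup : ∀ n ≥ N, (runLen n x : ℝ) < b * n) :
    ∃ m ≥ N, lurothD (m + 1) x ≠ lurothD m x := by
  by_contra! hcon
  have hconst : ∀ n ≥ N, lurothD n x = lurothD N x := fun n hn =>
    Nat.le_induction rfl (fun n hn ih => (hcon n hn).trans ih) n hn
  obtain ⟨n, hn⟩ := exists_nat_gt ((N : ℝ) / (1 - b))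
  rw [div_lt_iff₀ (by linarith)] at hn
  have h1 := hup (N + (n + 1)) (by omega)
  have h2 : n + 1 ≤ runLen (N + (n + 1)) x := le_runLen (by omega) le_rfl fun i _ _ =>
    (hconst _ (by omega)).trans (hconst _ (by omega)).symm
  have h3 : ((n + 1 : ℕ) : ℝ) ≤ runLen (N + (n + 1)) x := by exact_mod_cast h2
  have hN : (0 : ℝ) ≤ N := N.cast_nonneg
  push_cast at h1 h3
  nlinarith

/-- In the range `β / (1 + β) < α`, `0 < β < 1`, the level set is empty. -/
lemma Eab_eq_empty {α β : ℝ} (hβ0 : 0 < β) (hβ1 : β < 1) (h1 : β / (1 + β) < α) :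
    Eab α β = ∅ := by
  refine Set.eq_empty_of_forall_notMem fun x ⟨_, hinf, hsup⟩ => ?_
  obtain ⟨a, hβa, haα⟩ := exists_between (lt_min h1 ((div_lt_one (by linarith)).2
    (by linarith : β < 1 + β)))
  have ha1 : a < 1 := haα.trans_le (min_le_right _ _)
  rw [div_lt_iff₀ (by linarith)] at hβa
  have hβa' : β < a / (1 - a) := by
    rw [lt_div_iff₀ (by linarith)]
    linarith
  obtain ⟨b, hβb, hb⟩ := exists_between (lt_min hβ1 hβa')
  have hb1 : b < 1 := hb.trans_le (min_le_left _ _)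
  have hba := hb.trans_le (min_le_right _ _)
  rw [lt_div_iff₀ (by linarith)] at hba
  have hle1 : ∀ n : ℕ, (runLen n x : ℝ) / n ≤ 1 := fun n =>
    div_le_one_of_le₀ (by exact_mod_cast runLen_le n x) (by positivity)
  have hev1 := eventually_lt_of_lt_liminf (hinf ▸ haα.trans_le (min_le_left _ _))
    (isBoundedUnder_of ⟨0, fun n => by positivity⟩)
  have hev2 := eventually_lt_of_limsup_lt (hsup ▸ hβb) (isBoundedUnder_of ⟨1, hle1⟩)
  obtain ⟨N, hN⟩ := eventually_atTop.1 ((hev1.and hev2).and (eventually_ge_atTop 1))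
  have hpos : ∀ n ≥ N, (0 : ℝ) < n := fun n hn => by exact_mod_cast (hN n hn).2
  have hlow : ∀ n ≥ N, a * n < runLen n x := fun n hn =>
    (lt_div_iff₀ (hpos n hn)).1 (hN n hn).1.1
  have hup : ∀ n ≥ N, (runLen n x : ℝ) < b * n := fun n hn =>
    (div_lt_iff₀ (hpos n hn)).1 (hN n hn).1.2
  obtain ⟨m, hmN, hne⟩ := exists_lurothD_succ_ne hb1 hup
  have hm1 : 1 ≤ m := (hN m hmN).2
  have h4 : (runLen (m + runLen m x) x : ℝ) ≤ runLen m x := by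
    exact_mod_cast runLen_add_runLen_le hm1 hne
  have h5 := hlow (m + runLen m x) (by omega)
  push_cast at h5
  have h6 := hup m hmN
  have h7 := hpos m hmN
  nlinarith

/-- If β/(1+β) < α ≤ β < 1 and β > 0, then every x ∈ E(α,β) has eventually periodic
    Lüroth digits; consequently E(α,β) is countable and has Hausdorff dimension 0. -/
theorem luroth_Eαβ_periodic_countable (α β : ℝ) (hβ0 : 0 < β) (hβ1 : β < 1)
    (h1 : β / (1 + β) < α) (h2 : α ≤ β) :
    (∀ x ∈ Eab α β, LurothEventuallyPeriodic x) ∧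
    (Eab α β).Countable ∧ dimH (Eab α β) = 0 := by
  rw [Eab_eq_empty hβ0 hβ1 h1]
  exact ⟨fun x hx => hx.elim, Set.countable_empty, dimH_empty⟩
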